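/- For any nonzero integers v1,...,vn, the maximum loneliness ML(v1,...,vn) := sup_{t∈ℝ} min_i ‖t·v_i‖_{ℝ/ℤ} satisfies ML(v1,...,vn) ≥ 1/(2n), where ‖x‖_{ℝ/ℤ} denotes the distance from x to the nearest integer. -/

import Mathlib

/-- Distance from a real number to the nearest integer. -/
noncomputable def distToInt (x : ℝ) : ℝ := ⨅ m : ℤ, |x - m|

/-- Maximum loneliness of a tuple of speeds. -/
noncomputable def ML {n : ℕ} (v : Fin n → ℤ) : ℝ :=
  ⨆ t : ℝ, ⨅ i : Fin n, distToInt (t * v i)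

open MeasureTheory in
/-- For integers `v i ≠ 0` and `δ < 1 / (2n)`, some real `t` keeps every `t * v i` at distance
more than `δ` from the integers. -/
theorem exists_forall_lt_norm_coe_mul {n : ℕ} (v : Fin n → ℤ) (hv : ∀ i, v i ≠ 0) {δ : ℝ}
    (hδ : n * (2 * δ) < 1) : ∃ t : ℝ, ∀ i, δ < ‖((t * v i : ℝ) : UnitAddCircle)‖ := by
  rcases lt_or_ge δ 0 with hneg | hpos
  · exact ⟨0, fun i => hneg.trans_le (norm_nonneg _)⟩
  let A : Fin n → Set UnitAddCircle := fun i => (v i • ·) ⁻¹' Metric.closedBall 0 δ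
  have hA : ∀ i, volume (A i) ≤ ENNReal.ofReal (2 * δ) := fun i => by
    rw [(Measure.measurePreserving_zsmul volume (hv i)).measure_preimage
      measurableSet_closedBall.nullMeasurableSet, AddCircle.volume_closedBall]
    exact ENNReal.ofReal_le_ofReal (min_le_right _ _)
  have hU : volume (⋃ i, A i) < 1 := calc
    volume (⋃ i, A i) ≤ ∑ i, volume (A i) := measure_iUnion_fintype_le _ _
    _ ≤ ∑ _i : Fin n, ENNReal.ofReal (2 * δ) := Finset.sum_le_sum fun i _ => hA i
    _ = ENNReal.ofReal (n * (2 * δ)) := by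
      rw [Finset.sum_const, Finset.card_univ, Fintype.card_fin, nsmul_eq_mul,
        ENNReal.ofReal_mul n.cast_nonneg, ENNReal.ofReal_natCast]
    _ < 1 := ENNReal.ofReal_lt_one.2 hδ
  obtain ⟨x, hx⟩ : ∃ x, x ∉ ⋃ i, A i := by
    by_contra! h
    rw [Set.eq_univ_of_forall h, UnitAddCircle.measure_univ] at hU
    exact hU.false
  obtain ⟨t, rfl⟩ := QuotientAddGroup.mk_surjective x
  refine ⟨t, fun i => ?_⟩
  have hi : (t : UnitAddCircle) ∉ A i := fun h => hx (Set.mem_iUnion_of_mem i h)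
  simp only [A, Set.mem_preimage, mem_closedBall_zero_iff, not_le] at hi
  rwa [mul_comm, ← zsmul_eq_mul, AddCircle.coe_zsmul]

theorem norm_coe_le_distToInt (x : ℝ) : ‖(x : UnitAddCircle)‖ ≤ distToInt x :=
  le_ciInf fun m => by
    rw [UnitAddCircle.norm_eq]
    exact round_le x m

theorem bddBelow_range_abs_sub_intCast (x : ℝ) :
    BddBelow (Set.range fun m : ℤ => |x - m|) :=
  ⟨0, by rintro _ ⟨m, rfl⟩; exact abs_nonneg _⟩

theorem distToInt_le_half (x : ℝ) : distToInt x ≤ 1 / 2 :=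
  (ciInf_le (bddBelow_range_abs_sub_intCast x) (round x)).trans (abs_sub_round x)

theorem lonely_runner_trivial_bound (n : ℕ) (hn : 0 < n) (v : Fin n → ℤ)
    (hv : ∀ i, v i ≠ 0) : ML v ≥ 1 / (2 * n) := by
  have : Nonempty (Fin n) := ⟨⟨0, hn⟩⟩
  have hbdd : BddAbove (Set.range fun t : ℝ => ⨅ i : Fin n, distToInt (t * v i)) := by
    refine ⟨1 / 2, ?_⟩
    rintro _ ⟨t, rfl⟩
    exact (ciInf_le (Set.finite_range _).bddBelow ⟨0, hn⟩).trans (distToInt_le_half _)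
  refine le_of_forall_lt fun δ hδ => ?_
  obtain ⟨ε, hδε, hε⟩ := exists_between hδ
  obtain ⟨t, ht⟩ := exists_forall_lt_norm_coe_mul v hv (δ := ε) (by
    rw [lt_div_iff₀ (by positivity)] at hε
    linarith)
  exact hδε.trans_le ((le_ciInf fun i => (ht i).le.trans (norm_coe_le_distToInt _)).trans
    (le_ciSup hbdd t))
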